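/- Existence and uniqueness of the discounted-cost value function for the predictor MDP: let β ∈ (0,1) and c : 𝕏×𝕌 → ℝ be given. The Bellman operator T, defined on the space C_b(P(𝕏)) of bounded continuous real-valued functions on the simplex by (Tf)(π) := min_{(Q,η) ∈ 𝒬×ℋ} [ c̃(π,Q,η) + β Σ_{q ∈ ℳ : π(Q⁻¹(q)) > 0} f(F(π,Q,η,q)) · π(Q⁻¹(q)) ], maps C_b(P(𝕏)) into itself, is a contraction with modulus β in the supremum norm, and hence admits a unique fixed point J*_β ∈ C_b(P(𝕏)) satisfying the discounted cost optimality equation J*_β = T J*_β. -/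

import Mathlib

open Finset

noncomputable section

variable {X U M : Type}

/-- `π` is a probability mass function on the finite set `X`. -/
def IsPmf [Fintype X] (π : X → ℝ) : Prop :=
  (∀ x, 0 ≤ π x) ∧ ∑ x, π x = 1

/-- Mass that `π` assigns to the cell `Q⁻¹(q)`. -/
def mass [Fintype X] [DecidableEq M] (π : X → ℝ) (Q : X → M) (q : M) : ℝ :=
  ∑ x ∈ Finset.univ.filter (fun x => Q x = q), π x

/-- One-step predictor (Bayesian) update `F(π,Q,η,q)`. -/
def Fupd [Fintype X] [DecidableEq M] (P : X → U → X → ℝ)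
    (π : X → ℝ) (Q : X → M) (η : (X → M) → M → U) (q : M) : X → ℝ :=
  fun x' => (mass π Q q)⁻¹ *
    ∑ x ∈ Finset.univ.filter (fun x => Q x = q), P x (η Q q) x' * π x

/-- The equivalent per-stage cost `c̃(π,Q,η) := Σ_x π(x) c(x, η(Q, Q(x)))`. -/
def ctilde [Fintype X] (c : X → U → ℝ) (π : X → ℝ) (Q : X → M)
    (η : (X → M) → M → U) : ℝ :=
  ∑ x, π x * c x (η Q (Q x))

/-- The Bellman operator of the predictor MDP:
`(Tf)(π) := min_{(Q,η)} [ c̃(π,Q,η) + β Σ_{q : π(Q⁻¹(q)) > 0} f(F(π,Q,η,q)) π(Q⁻¹(q)) ]`. -/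
def bellman [Fintype X] [Fintype U] [Fintype M]
    [Nonempty X] [Nonempty U] [Nonempty M] [DecidableEq X] [DecidableEq M]
    (P : X → U → X → ℝ) (c : X → U → ℝ) (β : ℝ)
    (f : (X → ℝ) → ℝ) (π : X → ℝ) : ℝ :=
  Finset.univ.inf' Finset.univ_nonempty
    (fun Qη : (X → M) × ((X → M) → M → U) =>
      ctilde c π Qη.1 Qη.2 +
        β * ∑ q : M,
          (if 0 < mass π Qη.1 q then f (Fupd P π Qη.1 Qη.2 q) * mass π Qη.1 q else 0))

section helpers
set_option linter.unusedSectionVars false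
variable [Fintype X] [Fintype U] [Fintype M]
    [Nonempty X] [Nonempty U] [Nonempty M] [DecidableEq X] [DecidableEq M]

lemma mass_nonneg' {π : X → ℝ} (h : IsPmf π) (Q : X → M) (q : M) : 0 ≤ mass π Q q :=
  Finset.sum_nonneg fun x _ => h.1 x

lemma sum_mass' {π : X → ℝ} (h : IsPmf π) (Q : X → M) : ∑ q, mass π Q q = 1 := by
  unfold mass
  rw [Finset.sum_fiberwise]
  exact h.2

lemma isPmf_Fupd {P : X → U → X → ℝ} (hP : ∀ x u, IsPmf (P x u)) {π : X → ℝ} (h : IsPmf π)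
    (Q : X → M) (η : (X → M) → M → U) (q : M) (hm : 0 < mass π Q q) :
    IsPmf (Fupd P π Q η q) := by
  refine ⟨fun x' => mul_nonneg (inv_nonneg.2 hm.le)
    (Finset.sum_nonneg fun x _ => mul_nonneg ((hP _ _).1 _) (h.1 _)), ?_⟩
  unfold Fupd
  rw [← Finset.mul_sum, Finset.sum_comm]
  have : ∀ x, ∑ x', P x (η Q q) x' * π x = π x := fun x => by
    rw [← Finset.sum_mul, (hP _ _).2, one_mul]
  simp only [this]
  exact inv_mul_cancel₀ hm.ne'

lemma continuous_mass (Q : X → M) (q : M) : Continuous fun π : X → ℝ => mass π Q q := by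
  unfold mass
  fun_prop

lemma continuousOn_term {P : X → U → X → ℝ} (hP : ∀ x u, IsPmf (P x u))
    (f : (X → ℝ) → ℝ) (hf : ContinuousOn f {π : X → ℝ | IsPmf π}) (C : ℝ)
    (hC : ∀ π : X → ℝ, IsPmf π → |f π| ≤ C) (Q : X → M) (η : (X → M) → M → U) (q : M) :
    ContinuousOn (fun π : X → ℝ =>
      if 0 < mass π Q q then f (Fupd P π Q η q) * mass π Q q else 0) {π : X → ℝ | IsPmf π} := by
  intro π₀ h₀
  by_cases hm : 0 < mass π₀ Q q
  · have hev : ∀ᶠ π in nhds π₀, 0 < mass π Q q :=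
      (continuous_mass Q q).continuousAt.eventually (lt_mem_nhds hm)
    have hF : ContinuousAt (fun π : X → ℝ => Fupd P π Q η q) π₀ := by
      unfold Fupd
      refine continuousAt_pi.2 fun x' => ?_
      refine ContinuousAt.mul ((continuous_mass Q q).continuousAt.inv₀ hm.ne') ?_
      exact (continuous_finsetSum _ fun x _ => by fun_prop).continuousAt
    have h1 : Filter.Tendsto (fun π : X → ℝ => Fupd P π Q η q)
        (nhdsWithin π₀ {π : X → ℝ | IsPmf π})
        (nhdsWithin (Fupd P π₀ Q η q) {π : X → ℝ | IsPmf π}) := by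
      refine tendsto_nhdsWithin_iff.2 ⟨hF.mono_left nhdsWithin_le_nhds, ?_⟩
      filter_upwards [nhdsWithin_le_nhds hev, self_mem_nhdsWithin] with π h2 h3
      exact isPmf_Fupd hP h3 Q η q h2
    have h2 := (hf _ (isPmf_Fupd hP h₀ Q η q hm)).tendsto.comp h1
    have h3 : ContinuousWithinAt (fun π : X → ℝ => f (Fupd P π Q η q) * mass π Q q)
        {π : X → ℝ | IsPmf π} π₀ :=
      Filter.Tendsto.mul h2 (continuous_mass Q q).continuousWithinAt
    refine h3.congr_of_eventuallyEq ?_ ?_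
    · filter_upwards [nhdsWithin_le_nhds hev] with π h4
      simp [h4]
    · simp [hm]
  · have h0 : mass π₀ Q q = 0 := le_antisymm (not_lt.1 hm) (mass_nonneg' h₀ Q q)
    have ht : Filter.Tendsto (fun π : X → ℝ => C * mass π Q q)
        (nhdsWithin π₀ {π : X → ℝ | IsPmf π}) (nhds 0) := by
      have : Continuous fun π : X → ℝ => C * mass π Q q := (continuous_mass Q q).const_mul C
      have := this.continuousWithinAt (s := {π : X → ℝ | IsPmf π}) (x := π₀)
      simpa [ContinuousWithinAt, h0] using this
    unfold ContinuousWithinAt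
    beta_reduce
    rw [if_neg hm]
    refine squeeze_zero_norm' ?_ ht
    filter_upwards [self_mem_nhdsWithin] with π h
    have hn := mass_nonneg' h Q q
    split_ifs with h2
    · rw [Real.norm_eq_abs, abs_mul, abs_of_nonneg hn]
      exact mul_le_mul_of_nonneg_right (hC _ (isPmf_Fupd hP h Q η q h2)) hn
    · have : mass π Q q = 0 := le_antisymm (not_lt.1 h2) hn
      simp [this]

lemma continuousOn_bellman {P : X → U → X → ℝ} (hP : ∀ x u, IsPmf (P x u)) (c : X → U → ℝ)
    (β : ℝ) (f : (X → ℝ) → ℝ) (hf : ContinuousOn f {π : X → ℝ | IsPmf π}) (C : ℝ)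
    (hC : ∀ π : X → ℝ, IsPmf π → |f π| ≤ C) :
    ContinuousOn (bellman (M := M) P c β f) {π : X → ℝ | IsPmf π} := by
  unfold bellman
  refine ContinuousOn.finset_inf'_apply _ fun Qη _ => ?_
  refine ContinuousOn.add ?_ (continuousOn_const.mul
    (continuousOn_finsetSum _ fun q _ => continuousOn_term hP f hf C hC _ _ q))
  unfold ctilde
  fun_prop

lemma abs_inf'_sub_le {ι : Type} (s : Finset ι) (hs : s.Nonempty) (a b : ι → ℝ) (K : ℝ)
    (h : ∀ i ∈ s, |a i - b i| ≤ K) : |s.inf' hs a - s.inf' hs b| ≤ K := by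
  have key : ∀ a b : ι → ℝ, (∀ i ∈ s, |a i - b i| ≤ K) → s.inf' hs a - s.inf' hs b ≤ K := by
    intro a b h
    obtain ⟨i, hi, hb⟩ := Finset.exists_mem_eq_inf' hs b
    rw [hb]
    have h1 := Finset.inf'_le a hi
    have h2 := (abs_le.1 (h i hi)).2
    linarith
  refine abs_le.2 ⟨?_, key a b h⟩
  have := key b a fun i hi => by rw [abs_sub_comm]; exact h i hi
  linarith

lemma bellman_sub_le {P : X → U → X → ℝ} (hP : ∀ x u, IsPmf (P x u)) (c : X → U → ℝ)
    {β : ℝ} (hβ : 0 < β) (f g : (X → ℝ) → ℝ) (K : ℝ)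
    (hK : ∀ π : X → ℝ, IsPmf π → |f π - g π| ≤ K) (π : X → ℝ) (h : IsPmf π) :
    |bellman (M := M) P c β f π - bellman (M := M) P c β g π| ≤ β * K := by
  unfold bellman
  refine abs_inf'_sub_le _ _ _ _ _ fun Qη _ => ?_
  rw [add_sub_add_left_eq_sub, ← mul_sub, abs_mul, abs_of_pos hβ, ← Finset.sum_sub_distrib]
  refine mul_le_mul_of_nonneg_left ?_ hβ.le
  calc _ ≤ ∑ q, K * mass π Qη.1 q := by
        refine (Finset.abs_sum_le_sum_abs _ _).trans (Finset.sum_le_sum fun q _ => ?_)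
        have hn := mass_nonneg' h Qη.1 q
        split_ifs with h2
        · rw [← sub_mul, abs_mul, abs_of_nonneg hn]
          exact mul_le_mul_of_nonneg_right (hK _ (isPmf_Fupd hP h _ _ q h2)) hn
        · have : mass π Qη.1 q = 0 := le_antisymm (not_lt.1 h2) hn
          simp [this]
    _ = K := by rw [← Finset.mul_sum, sum_mass' h, mul_one]

lemma isCompact_pmf : IsCompact {π : X → ℝ | IsPmf π} := isCompact_stdSimplex ℝ X

lemma nonempty_pmf : Nonempty {p : X → ℝ // IsPmf p} := by
  obtain ⟨x⟩ := ‹Nonempty X›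
  exact ⟨⟨Pi.single x 1, single_mem_stdSimplex ℝ x⟩⟩

end helpers

/-- Existence and uniqueness of the discounted-cost value function for
the predictor MDP: for `β ∈ (0,1)`, the Bellman operator `T` maps `C_b(P(𝕏))` (bounded
continuous functions on the simplex) into itself, is a `β`-contraction in the supremum
norm, and hence admits a unique fixed point `J*_β ∈ C_b(P(𝕏))` satisfying the
discounted cost optimality equation `J*_β = T J*_β`. -/
theorem bellman_contraction_fixed_point
    [Fintype X] [Fintype U] [Fintype M]
    [Nonempty X] [Nonempty U] [Nonempty M] [DecidableEq X] [DecidableEq M]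
    (P : X → U → X → ℝ) (hP : ∀ x u, IsPmf (P x u)) (c : X → U → ℝ)
    (β : ℝ) (hβ0 : 0 < β) (hβ1 : β < 1) :
    -- (a) `T` maps `C_b(P(𝕏))` into itself
    ((∀ f : (X → ℝ) → ℝ, ContinuousOn f {π : X → ℝ | IsPmf π} →
        (∃ C : ℝ, ∀ π : X → ℝ, IsPmf π → |f π| ≤ C) →
        ContinuousOn (bellman (M := M) P c β f) {π : X → ℝ | IsPmf π} ∧
          ∃ C : ℝ, ∀ π : X → ℝ, IsPmf π → |bellman (M := M) P c β f π| ≤ C)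
    -- (b) `T` is a contraction with modulus `β` in the supremum norm
    ∧ (∀ f g : (X → ℝ) → ℝ,
        (∃ C : ℝ, ∀ π : X → ℝ, IsPmf π → |f π| ≤ C) →
        (∃ C : ℝ, ∀ π : X → ℝ, IsPmf π → |g π| ≤ C) →
        ∀ π : X → ℝ, IsPmf π →
          |bellman (M := M) P c β f π - bellman (M := M) P c β g π| ≤
            β * ⨆ ν : {p : X → ℝ // IsPmf p}, |f ν.1 - g ν.1|)
    -- (c) unique fixed point in `C_b(P(𝕏))`
    ∧ (∃ J : (X → ℝ) → ℝ,
        (ContinuousOn J {π : X → ℝ | IsPmf π} ∧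
          (∃ C : ℝ, ∀ π : X → ℝ, IsPmf π → |J π| ≤ C) ∧
          ∀ π : X → ℝ, IsPmf π → J π = bellman (M := M) P c β J π) ∧
        ∀ J' : (X → ℝ) → ℝ,
          (ContinuousOn J' {π : X → ℝ | IsPmf π} ∧
            (∃ C : ℝ, ∀ π : X → ℝ, IsPmf π → |J' π| ≤ C) ∧
            ∀ π : X → ℝ, IsPmf π → J' π = bellman (M := M) P c β J' π) →
          ∀ π : X → ℝ, IsPmf π → J' π = J π)) := by
  have hbd : ∀ f : (X → ℝ) → ℝ, ContinuousOn f {π : X → ℝ | IsPmf π} →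
      ∃ C : ℝ, ∀ π : X → ℝ, IsPmf π → |f π| ≤ C := fun f hf =>
    isCompact_pmf.exists_bound_of_continuousOn hf
  have hb : ∀ f g : (X → ℝ) → ℝ,
        (∃ C : ℝ, ∀ π : X → ℝ, IsPmf π → |f π| ≤ C) →
        (∃ C : ℝ, ∀ π : X → ℝ, IsPmf π → |g π| ≤ C) →
        ∀ π : X → ℝ, IsPmf π → |f π - g π| ≤ ⨆ ν : {p : X → ℝ // IsPmf p}, |f ν.1 - g ν.1| := by
    rintro f g ⟨C, hC⟩ ⟨D, hD⟩ π h
    refine le_ciSup (f := fun ν : {p : X → ℝ // IsPmf p} => |f ν.1 - g ν.1|) ?_ ⟨π, h⟩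
    refine ⟨C + D, ?_⟩
    rintro _ ⟨ν, rfl⟩
    exact (abs_sub _ _).trans (add_le_add (hC _ ν.2) (hD _ ν.2))
  refine ⟨fun f hf ⟨C, hC⟩ => ?_, fun f g hf hg π h => ?_, ?_⟩
  · have := continuousOn_bellman (M := M) hP c β f hf C hC
    exact ⟨this, hbd _ this⟩
  · exact bellman_sub_le hP c hβ0 f g _ (hb f g hf hg) π h
  · classical
    have : CompactSpace {p : X → ℝ // IsPmf p} := isCompact_iff_compactSpace.1 isCompact_pmf
    have := nonempty_pmf (X := X)
    let ext : C({p : X → ℝ // IsPmf p}, ℝ) → (X → ℝ) → ℝ :=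
      fun f π => if h : IsPmf π then f ⟨π, h⟩ else 0
    have hext : ∀ f (ν : {p : X → ℝ // IsPmf p}), ext f ν.1 = f ν := fun f ν => by
      simp [ext, ν.2]
    have hextc : ∀ f, ContinuousOn (ext f) {π : X → ℝ | IsPmf π} := fun f => by
      rw [continuousOn_iff_continuous_domRestrict]
      have : Set.domRestrict {π : X → ℝ | IsPmf π} (ext f) = f := by
        funext ν
        exact hext f ν
      rw [this]
      exact f.continuous
    have hTc : ∀ f, ContinuousOn (bellman (M := M) P c β (ext f)) {π : X → ℝ | IsPmf π} :=
      fun f => by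
        obtain ⟨C, hC⟩ := hbd _ (hextc f)
        exact continuousOn_bellman hP c β _ (hextc f) C hC
    let T : C({p : X → ℝ // IsPmf p}, ℝ) → C({p : X → ℝ // IsPmf p}, ℝ) := fun f =>
      ⟨fun ν => bellman (M := M) P c β (ext f) ν.1,
        continuousOn_iff_continuous_domRestrict.1 (hTc f)⟩
    have hT : ContractingWith ⟨β, hβ0.le⟩ T := by
      refine ⟨hβ1, LipschitzWith.of_dist_le_mul fun f g => ?_⟩
      refine (ContinuousMap.dist_le (mul_nonneg hβ0.le dist_nonneg)).2 fun ν => ?_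
      refine bellman_sub_le hP c hβ0 (ext f) (ext g) _ (fun π h => ?_) ν.1 ν.2
      rw [hext f ⟨π, h⟩, hext g ⟨π, h⟩]
      exact ContinuousMap.dist_apply_le_dist (f := f) (g := g) ⟨π, h⟩
    let J := hT.fixedPoint T
    have hJ : T J = J := hT.fixedPoint_isFixedPt
    have hJ' : ∀ π : X → ℝ, IsPmf π → ext J π = bellman (M := M) P c β (ext J) π := by
      intro π h
      rw [hext J ⟨π, h⟩]
      exact (DFunLike.congr_fun hJ ⟨π, h⟩).symm
    refine ⟨ext J, ⟨hextc J, hbd _ (hextc J), hJ'⟩, ?_⟩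
    rintro K ⟨-, hK2, hK3⟩ π h
    have h1 := hb K (ext J) hK2 (hbd _ (hextc J))
    have h2 : (⨆ ν : {p : X → ℝ // IsPmf p}, |K ν.1 - ext J ν.1|) ≤
        β * ⨆ ν : {p : X → ℝ // IsPmf p}, |K ν.1 - ext J ν.1| := by
      refine ciSup_le fun ν => ?_
      conv_lhs => rw [hK3 ν.1 ν.2, hJ' ν.1 ν.2]
      exact bellman_sub_le hP c hβ0 K (ext J) _ h1 ν.1 ν.2
    have h3 := h1 π h
    have h4 : |K π - ext J π| ≤ 0 := by nlinarith
    exact sub_eq_zero.1 (abs_nonpos_iff.1 h4)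

end
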